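/- arXiv:0905.1294 — 2 statements merged into one kernel-verified Lean document; each statement's English description precedes it below -/
import Mathlib

section
/- Let r ≥ 3 be a natural number and let (b_n)_{n≥1} be a real sequence belonging to GM(β*, r). If n·|b_n| → 0 as n → ∞ and ∑_{n=1}^∞ ∑_{k=1}^{⌊r/2⌋} |b_{r·n+k} − b_{r·n+r−k}| < ∞, then the series ∑_{n=1}^∞ b_n sin(nx) converges uniformly in x on ℝ. -/
open Finset Filter

/-- The class `GM(β*, r)` for real sequences: `b` belongs to it if there exist `K > 0` and
`c > 1` such that for every `m ≥ 1`,
`∑_{n=m}^{2m-1} |b_n − b_{n+r}| ≤ K (∑_{k=m}^{m+r-1} |b_k| + ∑_{k=max(1,⌊m/c⌋)}^{⌊cm⌋} |b_k|/k)`. -/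
def GMstar (b : ℕ → ℝ) (r : ℕ) : Prop :=
  ∃ K : ℝ, 0 < K ∧ ∃ c : ℝ, 1 < c ∧ ∀ m : ℕ, 1 ≤ m →
    (∑ n ∈ Finset.Icc m (2 * m - 1), |b n - b (n + r)|) ≤
      K * ((∑ k ∈ Finset.Icc m (m + r - 1), |b k|) +
        ∑ k ∈ Finset.Icc (max 1 ⌊(m : ℝ) / c⌋₊) ⌊c * (m : ℝ)⌋₊, |b k| / (k : ℝ))

/-- The partial sums of the sine series `∑ b_n sin (n x)`. -/
noncomputable def sinePartialSum (b : ℕ → ℝ) (N : ℕ) (x : ℝ) : ℝ :=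
  ∑ n ∈ Finset.Icc 1 N, b n * Real.sin (n * x)


/-- A nonnegative sequence whose dyadic block sums are `≤ A / m` has tails `≤ 2 * A / M`. -/
lemma sum_Ico_le_of_dyadic {f : ℕ → ℝ} (hf : ∀ n, 0 ≤ f n) {A : ℝ} {M₀ : ℕ} (hM₀ : 1 ≤ M₀)
    (hA : ∀ m, M₀ ≤ m → ∑ n ∈ Ico m (2 * m), f n ≤ A / m) {M : ℕ} (hM : M₀ ≤ M) (N : ℕ) :
    ∑ n ∈ Ico M N, f n ≤ 2 * A / M := by
  have hMpos : (0 : ℝ) < M := by exact_mod_cast (by omega : 0 < M)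
  have hA0 : 0 ≤ A := by
    have h := (sum_nonneg fun n _ => hf n).trans (hA M hM)
    simpa using (le_div_iff₀ hMpos).1 h
  have key : ∀ k : ℕ, ∑ n ∈ Ico M (2 ^ k * M), f n ≤ 2 * A / M * (1 - (1 / 2) ^ k) := by
    intro k
    induction k with
    | zero => simp
    | succ k ih =>
      have h1 : M ≤ 2 ^ k * M := Nat.le_mul_of_pos_left _ (by positivity)
      have h2 : 2 ^ k * M ≤ 2 ^ (k + 1) * M := by gcongr <;> omega
      rw [← sum_Ico_consecutive f h1 h2]
      have h3 := hA (2 ^ k * M) (hM.trans h1)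
      rw [show 2 * (2 ^ k * M) = 2 ^ (k + 1) * M by ring] at h3
      have h4 : A / ((2 ^ k * M : ℕ) : ℝ) = A / M * (1 / 2) ^ k := by
        push_cast
        rw [one_div, inv_pow]
        field_simp
      rw [h4] at h3
      calc _ ≤ 2 * A / M * (1 - (1 / 2) ^ k) + A / M * (1 / 2) ^ k := add_le_add ih h3
        _ = _ := by ring
  calc ∑ n ∈ Ico M N, f n ≤ ∑ n ∈ Ico M (2 ^ N * M), f n := by
        refine sum_le_sum_of_subset_of_nonneg (Ico_subset_Ico_right ?_) fun n _ _ => hf n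
        exact Nat.lt_two_pow_self.le.trans (Nat.le_mul_of_pos_right _ (by omega))
    _ ≤ 2 * A / M * (1 - (1 / 2) ^ N) := key N
    _ ≤ 2 * A / M * 1 := by
        gcongr
        linarith [pow_nonneg (by norm_num : (0 : ℝ) ≤ 1 / 2) N]
    _ = _ := mul_one _

lemma exists_mul_abs_le {b : ℕ → ℝ} (hto : Tendsto (fun n : ℕ => (n : ℝ) * |b n|) atTop (nhds 0))
    {ε : ℝ} (hε : 0 < ε) : ∃ M₀ : ℕ, 1 ≤ M₀ ∧ ∀ n, M₀ ≤ n → n * |b n| ≤ ε := by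
  obtain ⟨M, hM⟩ := eventually_atTop.1 (hto.eventually_le_const hε)
  exact ⟨max 1 M, le_max_left _ _, fun n hn => hM n ((le_max_right _ _).trans hn)⟩

/-- For a sequence of class `GM(β*, r)` with `n * |b n| → 0`, the tails of `∑ |b n - b (n + r)|`
are `o(1 / M)`. -/
lemma GMstar.exists_tail_le {b : ℕ → ℝ} {r : ℕ} (hgm : GMstar b r)
    (hto : Tendsto (fun n : ℕ => (n : ℝ) * |b n|) atTop (nhds 0)) {ε : ℝ} (hε : 0 < ε) :
    ∃ M₀ : ℕ, 1 ≤ M₀ ∧ ∀ M, M₀ ≤ M → ∀ N,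
      ∑ n ∈ Ico M N, |b n - b (n + r)| ≤ ε / M := by
  obtain ⟨K, hK, c, hc, hb⟩ := hgm
  have hc0 : 0 < c := by linarith
  set B : ℝ := K * (r + 4 * c ^ 3) with hB
  have hBpos : 0 < B := by positivity
  set δ := ε / (2 * B) with hδ
  have hδpos : 0 < δ := by positivity
  obtain ⟨M₁, hM₁, hsmall⟩ := exists_mul_abs_le hto hδpos
  refine ⟨max M₁ ⌈2 * c * M₁⌉₊, hM₁.trans (le_max_left _ _), fun M hM N => ?_⟩
  have hblock : ∀ m, max M₁ ⌈2 * c * M₁⌉₊ ≤ m →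
      ∑ n ∈ Ico m (2 * m), |b n - b (n + r)| ≤ (B * δ) / m := by
    intro m hm
    have hm1 : M₁ ≤ m := (le_max_left _ _).trans hm
    have hm2 : 2 * c * M₁ ≤ m := (Nat.le_ceil _).trans (by exact_mod_cast (le_max_right _ _).trans hm)
    have hmpos : (0 : ℝ) < m := by exact_mod_cast (by omega : 0 < m)
    have hM₁' : (1 : ℝ) ≤ M₁ := by exact_mod_cast hM₁
    have hfirst : ∑ k ∈ Icc m (m + r - 1), |b k| ≤ r * (δ / m) := by
      have hcard : (Icc m (m + r - 1)).card = r := by rw [Nat.card_Icc]; omega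
      refine (sum_le_card_nsmul _ _ (δ / m) fun k hk => ?_).trans_eq (by rw [hcard, nsmul_eq_mul])
      have hk' := (mem_Icc.1 hk).1
      rw [le_div_iff₀ hmpos]
      have h := hsmall k (hm1.trans hk')
      have : (m : ℝ) ≤ k := by exact_mod_cast hk'
      nlinarith [abs_nonneg (b k)]
    have hsecond : ∑ k ∈ Icc (max 1 ⌊(m : ℝ) / c⌋₊) ⌊c * (m : ℝ)⌋₊, |b k| / (k : ℝ) ≤
        (c * m) * (4 * c ^ 2 * δ / m ^ 2) := by
      have hterm : ∀ k ∈ Icc (max 1 ⌊(m : ℝ) / c⌋₊) ⌊c * (m : ℝ)⌋₊,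
          |b k| / (k : ℝ) ≤ 4 * c ^ 2 * δ / m ^ 2 := by
        intro k hk
        have hk' := (le_max_right _ _).trans (mem_Icc.1 hk).1
        have h1 : (m : ℝ) / c < k + 1 :=
          (Nat.lt_floor_add_one _).trans_le (by exact_mod_cast Nat.succ_le_succ hk')
        have h2 : 2 * (M₁ : ℝ) ≤ m / c := by rw [le_div_iff₀ hc0]; linarith
        have h3 : M₁ ≤ k := by
          have : (M₁ : ℝ) < k + 1 := by linarith
          exact Nat.lt_succ_iff.1 (by exact_mod_cast this)
        have h3' : (M₁ : ℝ) ≤ k := by exact_mod_cast h3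
        have hkpos : (0 : ℝ) < k := by linarith
        have h4 : (m : ℝ) ≤ 2 * c * k := by
          have : (m : ℝ) / c ≤ 2 * k := by linarith
          rw [div_le_iff₀ hc0] at this
          linarith
        rw [div_le_div_iff₀ hkpos (by positivity)]
        have h5 : (m : ℝ) ^ 2 ≤ (2 * c * k) ^ 2 := by gcongr
        calc |b k| * m ^ 2 ≤ |b k| * (2 * c * k) ^ 2 := by gcongr
          _ = (k * |b k|) * (4 * c ^ 2 * k) := by ring
          _ ≤ δ * (4 * c ^ 2 * k) := by gcongr; exact hsmall k h3
          _ = _ := by ring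
      refine (sum_le_card_nsmul _ _ _ hterm).trans ?_
      rw [nsmul_eq_mul]
      gcongr
      refine le_trans ?_ (Nat.floor_le (by positivity : 0 ≤ c * (m : ℝ)))
      rw [Nat.card_Icc]
      have : 1 ≤ max 1 ⌊(m : ℝ) / c⌋₊ := le_max_left _ _
      exact_mod_cast (by omega)
    have hset : Ico m (2 * m) = Icc m (2 * m - 1) := by
      ext n; simp only [mem_Ico, mem_Icc]; omega
    rw [hset]
    calc _ ≤ _ := hb m (by omega)
      _ ≤ K * (r * (δ / m) + (c * m) * (4 * c ^ 2 * δ / m ^ 2)) := by gcongr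
      _ = _ := by rw [hB]; field_simp
  have h := sum_Ico_le_of_dyadic (f := fun n => |b n - b (n + r)|) (fun _ => abs_nonneg _)
    (hM₁.trans (le_max_left _ _)) hblock hM N
  refine h.trans_eq ?_
  rw [hδ]
  field_simp

/-- Summation by parts with step `r`. -/
lemma sum_Ico_mul_pow_mul_one_sub_pow (a : ℕ → ℂ) (z : ℂ) (r : ℕ) {M N : ℕ} (hMN : M ≤ N) :
    (∑ n ∈ Ico M N, a n * z ^ n) * (1 - z ^ r) =
      ∑ n ∈ Ico M (M + r), a n * z ^ n - ∑ n ∈ Ico N (N + r), a n * z ^ n +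
        ∑ n ∈ Ico M N, (a (n + r) - a n) * z ^ (n + r) := by
  induction N, hMN using Nat.le_induction with
  | base => simp
  | succ N hMN ih =>
    have h1 : ∑ n ∈ Ico N (N + r), a n * z ^ n + a (N + r) * z ^ (N + r) =
        a N * z ^ N + ∑ n ∈ Ico (N + 1) (N + 1 + r), a n * z ^ n := by
      rw [← sum_Ico_succ_top (Nat.le_add_right N r) fun n => a n * z ^ n,
        sum_eq_sum_Ico_succ_bot (by omega), add_right_comm]
    rw [sum_Ico_succ_top hMN, sum_Ico_succ_top hMN, add_mul, ih]
    linear_combination -h1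

lemma exists_abs_sum_sin_le_of_one_le_mul {b : ℕ → ℝ} {r : ℕ} (hr : 2 ≤ r) (hgm : GMstar b r)
    (hto : Tendsto (fun n : ℕ => (n : ℝ) * |b n|) atTop (nhds 0)) {ε : ℝ} (hε : 0 < ε) :
    ∃ M₀ : ℕ, 1 ≤ M₀ ∧ ∀ M, M₀ ≤ M → ∀ N (l : ℤ) (h : ℝ), |h| ≤ Real.pi / r → 1 ≤ M * |h| →
      |∑ n ∈ Ico M N, b n * Real.sin (n * (2 * Real.pi * l / r + h))| ≤ ε := by
  have hrpos : (0 : ℝ) < r := by exact_mod_cast (by omega : 0 < r)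
  set δ := ε / (2 * r + 1) with hδ
  have hδpos : 0 < δ := by positivity
  obtain ⟨M₁, hM₁, hsmall⟩ := exists_mul_abs_le hto hδpos
  obtain ⟨M₂, -, htail⟩ := hgm.exists_tail_le hto hδpos
  refine ⟨max M₁ M₂, hM₁.trans (le_max_left _ _), fun M hM N l h hh hMh => ?_⟩
  rcases le_total N M with hNM | hMN
  · simp [Ico_eq_empty_of_le hNM, hε.le]
  set x : ℝ := 2 * Real.pi * l / r + h with hx
  set z : ℂ := Complex.exp (x * Complex.I) with hz
  have hpow : ∀ n : ℕ, z ^ n = Complex.exp (((n * x : ℝ) : ℂ) * Complex.I) := by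
    intro n
    rw [hz, ← Complex.exp_nat_mul]
    push_cast
    ring_nf
  have hnorm : ∀ n : ℕ, ‖z ^ n‖ = 1 := fun n => by
    rw [hpow, Complex.norm_exp_ofReal_mul_I]
  have him : ∑ n ∈ Ico M N, b n * Real.sin (n * x) = (∑ n ∈ Ico M N, (b n : ℂ) * z ^ n).im := by
    rw [Complex.im_sum]
    refine sum_congr rfl fun n _ => ?_
    rw [Complex.im_ofReal_mul, hpow, Complex.exp_ofReal_mul_I_im]
  have hMpos : (0 : ℝ) < M := by
    exact_mod_cast (hM₁.trans ((le_max_left _ _).trans hM) : 0 < M)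
  have hblock : ∀ m, M ≤ m → ‖∑ n ∈ Ico m (m + r), (b n : ℂ) * z ^ n‖ ≤ r * (δ / M) := by
    intro m hm
    refine (norm_sum_le_of_le (f := fun n => (b n : ℂ) * z ^ n) (n := fun _ => δ / M) _
      fun n hn => ?_).trans_eq (by simp)
    have hMn : M ≤ n := hm.trans (mem_Ico.1 hn).1
    rw [norm_mul, hnorm, mul_one, Complex.norm_real, Real.norm_eq_abs, le_div_iff₀ hMpos]
    have h1 := hsmall n (((le_max_left _ _).trans hM).trans hMn)
    have h2 : (M : ℝ) ≤ n := by exact_mod_cast hMn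
    nlinarith [abs_nonneg (b n)]
  have hvar : ‖∑ n ∈ Ico M N, ((b (n + r) : ℂ) - b n) * z ^ (n + r)‖ ≤ δ / M := by
    refine (norm_sum_le_of_le (n := fun n => |b n - b (n + r)|) _ fun n _ => ?_).trans
      (htail M ((le_max_right _ _).trans hM) N)
    rw [norm_mul, hnorm, mul_one, ← Complex.ofReal_sub, Complex.norm_real, Real.norm_eq_abs,
      abs_sub_comm]
  have hlower : |h| ≤ ‖1 - z ^ r‖ := by
    have hzr : z ^ r = Complex.exp (Complex.I * ((r * h : ℝ) : ℂ)) := by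
      rw [hpow, Complex.exp_eq_exp_iff_exists_int]
      refine ⟨l, ?_⟩
      rw [hx]
      have : (r : ℂ) ≠ 0 := by exact_mod_cast hrpos.ne'
      push_cast
      field_simp
      ring
    rw [norm_sub_rev, hzr, Complex.norm_exp_I_mul_ofReal_sub_one, Real.norm_eq_abs, abs_mul,
      abs_two]
    have h1 : |r * h / 2| ≤ Real.pi / 2 := by
      rw [abs_div, abs_mul, Nat.abs_cast, abs_two]
      rw [le_div_iff₀ hrpos] at hh
      linarith
    have h2 := Real.mul_abs_le_abs_sin h1
    rw [abs_div, abs_mul, Nat.abs_cast, abs_two] at h2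
    have h3 : |h| * (Real.pi / 2) ≤ |h| * r := by
      have hr' : (2 : ℝ) ≤ r := by exact_mod_cast hr
      gcongr
      linarith [Real.pi_lt_four]
    rw [← le_div_iff₀ (by positivity)] at h3
    calc |h| ≤ |h| * r / (Real.pi / 2) := h3
      _ = 2 * (2 / Real.pi * (r * |h| / 2)) := by field_simp
      _ ≤ _ := by gcongr
  have hmul := congrArg norm (sum_Ico_mul_pow_mul_one_sub_pow (fun n => (b n : ℂ)) z r hMN)
  rw [norm_mul] at hmul
  have hupper : ‖∑ n ∈ Ico M N, (b n : ℂ) * z ^ n‖ * ‖1 - z ^ r‖ ≤ ε / M := by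
    rw [hmul]
    refine (norm_add_le_of_le (norm_sub_le_of_le (hblock M le_rfl) (hblock N hMN)) hvar).trans_eq ?_
    rw [hδ]
    field_simp
    ring
  rw [him]
  refine (Complex.abs_im_le_norm _).trans ?_
  set S := ‖∑ n ∈ Ico M N, (b n : ℂ) * z ^ n‖
  have hS : 0 ≤ S := norm_nonneg _
  calc S = S * 1 := (mul_one _).symm
    _ ≤ S * (M * ‖1 - z ^ r‖) := by gcongr; exact hMh.trans (by gcongr)
    _ = (S * ‖1 - z ^ r‖) * M := by ring
    _ ≤ ε / M * M := by gcongr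
    _ = ε := by field_simp

/-- Pairing `k` with `r - k` in a sum over a full period against an odd weight. -/
lemma abs_sum_range_mul_le_of_odd {r : ℕ} (hr : 1 ≤ r) (a s : ℕ → ℝ) (hs : ∀ k, |s k| ≤ 1)
    (hs0 : s 0 = 0) (hodd : ∀ k ≤ r, s (r - k) = -s k) :
    |∑ k ∈ range r, a k * s k| ≤ ∑ k ∈ Icc 1 (r / 2), |a k - a (r - k)| := by
  have hIco : ∑ k ∈ range r, a k * s k = ∑ k ∈ Ico 1 r, a k * s k := by
    rw [range_eq_Ico, sum_eq_sum_Ico_succ_bot (by omega), hs0, mul_zero, zero_add]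
  have hrefl : ∀ f : ℕ → ℝ, ∑ k ∈ Ico 1 r, f (r - k) = ∑ k ∈ Ico 1 r, f k := by
    intro f
    refine sum_nbij' (fun k => r - k) (fun k => r - k) ?_ ?_ ?_ ?_ ?_ <;>
      simp only [mem_Ico] <;> intro k hk
    · omega
    · omega
    · omega
    · omega
    · trivial
  have htwice : 2 * ∑ k ∈ Ico 1 r, a k * s k = ∑ k ∈ Ico 1 r, (a k - a (r - k)) * s k := by
    rw [two_mul]
    nth_rewrite 2 [← hrefl]
    rw [← sum_add_distrib]
    refine sum_congr rfl fun k hk => ?_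
    rw [hodd k (mem_Ico.1 hk).2.le]
    ring
  have habs : |∑ k ∈ Ico 1 r, (a k - a (r - k)) * s k| ≤ ∑ k ∈ Ico 1 r, |a k - a (r - k)| := by
    refine (abs_sum_le_sum_abs _ _).trans (sum_le_sum fun k _ => ?_)
    rw [abs_mul]
    exact mul_le_of_le_one_right (abs_nonneg _) (hs k)
  have hhalf : ∑ k ∈ Ico (r / 2 + 1) r, |a k - a (r - k)| ≤
      ∑ k ∈ Icc 1 (r / 2), |a k - a (r - k)| := by
    have h : ∑ k ∈ Ico (r / 2 + 1) r, |a k - a (r - k)| =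
        ∑ k ∈ Icc 1 (r - (r / 2 + 1)), |a k - a (r - k)| := by
      refine sum_nbij' (fun k => r - k) (fun k => r - k) ?_ ?_ ?_ ?_ ?_ <;>
        simp only [mem_Ico, mem_Icc] <;> intro k hk
      · omega
      · omega
      · omega
      · omega
      · rw [abs_sub_comm, show r - (r - k) = k by omega]
    rw [h]
    exact sum_le_sum_of_subset_of_nonneg (Icc_subset_Icc_right (by omega))
      fun _ _ _ => abs_nonneg _
  have hsplit : ∑ k ∈ Ico 1 r, |a k - a (r - k)| = ∑ k ∈ Icc 1 (r / 2), |a k - a (r - k)| +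
      ∑ k ∈ Ico (r / 2 + 1) r, |a k - a (r - k)| := by
    rw [← sum_Ico_consecutive _ (show 1 ≤ r / 2 + 1 by omega) (by omega)]
    rfl
  have h2 : 2 * |∑ k ∈ Ico 1 r, a k * s k| = |∑ k ∈ Ico 1 r, (a k - a (r - k)) * s k| := by
    rw [← htwice, abs_mul, abs_two]
  rw [hIco]
  linarith

lemma sum_Ico_mul_eq_sum_sum_range {r : ℕ} (g : ℕ → ℝ) {J J' : ℕ} (hJ : J ≤ J') :
    ∑ n ∈ Ico (r * J) (r * J'), g n = ∑ j ∈ Ico J J', ∑ k ∈ range r, g (r * j + k) := by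
  induction J', hJ using Nat.le_induction with
  | base => simp
  | succ J' hJ ih =>
    rw [sum_Ico_succ_top hJ, ← ih, ← sum_Ico_consecutive g (Nat.mul_le_mul_left r hJ)
      (Nat.mul_le_mul_left r J'.le_succ), sum_Ico_eq_sum_range g (r * J') (r * (J' + 1)), mul_add_one,
      Nat.add_sub_cancel_left]

/-- The series `∑ b n * sin (2 π l n / r)` are Cauchy uniformly in `l`. -/
lemma exists_abs_sum_sin_two_pi_div_le {b : ℕ → ℝ} {r : ℕ} (hr : 1 ≤ r)
    (hto : Tendsto (fun n : ℕ => (n : ℝ) * |b n|) atTop (nhds 0))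
    (hsum : Summable (fun n : ℕ =>
      ∑ k ∈ Icc 1 (r / 2), |b (r * n + k) - b (r * n + r - k)|)) {ε : ℝ} (hε : 0 < ε) :
    ∃ M₀ : ℕ, ∀ M, M₀ ≤ M → ∀ N, M ≤ N → ∀ l : ℤ,
      |∑ n ∈ Ico M N, b n * Real.sin (n * (2 * Real.pi * l / r))| ≤ ε := by
  have hrpos : (0 : ℝ) < r := by exact_mod_cast hr
  obtain ⟨M₁, hM₁, hsmall⟩ := exists_mul_abs_le hto (show 0 < ε / (3 * r) by positivity)
  obtain ⟨s, hs⟩ := summable_iff_vanishing_norm.1 hsum (ε / 3) (by positivity)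
  obtain ⟨J₀, hJ₀⟩ : ∃ J₀, ∀ j ∈ s, j < J₀ :=
    ⟨s.sup id + 1, fun j hj => Nat.lt_succ_of_le (le_sup (f := id) hj)⟩
  refine ⟨r * J₀ + M₁ + r, fun M hM N hMN l => ?_⟩
  set σ : ℕ → ℝ := fun n => Real.sin (n * (2 * Real.pi * l / r)) with hσ
  have hσ1 : ∀ n, |σ n| ≤ 1 := fun n => Real.abs_sin_le_one _
  have hper : ∀ j k, σ (r * j + k) = σ k := by
    intro j k
    have : ((r * j + k : ℕ) : ℝ) * (2 * Real.pi * l / r) =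
        k * (2 * Real.pi * l / r) + ((j * l : ℤ) : ℝ) * (2 * Real.pi) := by
      push_cast
      field_simp
      ring
    simp only [hσ]
    rw [this, Real.sin_add_int_mul_two_pi]
  have hodd : ∀ k ≤ r, σ (r - k) = -σ k := by
    intro k hk
    have : ((r - k : ℕ) : ℝ) * (2 * Real.pi * l / r) =
        l * (2 * Real.pi) - k * (2 * Real.pi * l / r) := by
      rw [Nat.cast_sub hk]
      field_simp
    simp only [hσ]
    rw [this, Real.sin_int_mul_two_pi_sub]
  have hpart : ∀ n, M ≤ n → |∑ k ∈ Ico (r * (n / r)) n, b k * σ k| ≤ ε / 3 := by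
    intro n hn
    have hdiv := Nat.div_add_mod n r
    have hmod := Nat.mod_lt n hr
    have hterm : ∀ k ∈ Ico (r * (n / r)) n, |b k * σ k| ≤ ε / (3 * r) := by
      intro k hk
      have hk' : M₁ ≤ k := by
        have := (mem_Ico.1 hk).1
        omega
      have hk1 : (1 : ℝ) ≤ k := by exact_mod_cast hM₁.trans hk'
      have h1 := hsmall k hk'
      rw [abs_mul]
      nlinarith [abs_nonneg (b k), hσ1 k]
    refine (abs_sum_le_sum_abs _ _).trans ((sum_le_card_nsmul _ _ _ hterm).trans ?_)
    have hcard : ((Ico (r * (n / r)) n).card : ℝ) ≤ r := by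
      rw [Nat.card_Ico]
      exact_mod_cast (by omega : n - r * (n / r) ≤ r)
    rw [nsmul_eq_mul]
    calc _ ≤ (r : ℝ) * (ε / (3 * r)) := by gcongr
      _ = ε / 3 := by field_simp
  have hJ : M / r ≤ N / r := Nat.div_le_div_right hMN
  have hblocks : |∑ n ∈ Ico (r * (M / r)) (r * (N / r)), b n * σ n| ≤ ε / 3 := by
    rw [sum_Ico_mul_eq_sum_sum_range _ hJ]
    have hdisj : Disjoint (Ico (M / r) (N / r)) s := by
      refine disjoint_left.2 fun j hj hjs => ?_
      have h1 := hJ₀ j hjs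
      have h2 : J₀ ≤ M / r := (Nat.le_div_iff_mul_le hr).2 (by rw [mul_comm]; omega)
      have h3 := (mem_Ico.1 hj).1
      omega
    refine (abs_sum_le_sum_abs _ _).trans (le_trans (sum_le_sum fun j _ => ?_)
      ((le_abs_self _).trans (hs _ hdisj).le))
    have h := abs_sum_range_mul_le_of_odd hr (fun k => b (r * j + k)) σ hσ1 (by simp [hσ]) hodd
    simp only [hper]
    refine h.trans_eq (sum_congr rfl fun k hk => ?_)
    have := mem_Icc.1 hk
    rw [Nat.add_sub_assoc (by omega)]
  have e1 := sum_Ico_consecutive (fun n => b n * σ n) (Nat.mul_div_le M r) hMN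
  have e2 := sum_Ico_consecutive (fun n => b n * σ n) (Nat.mul_le_mul_left r hJ)
    (Nat.mul_div_le N r)
  have h1 := abs_le.1 (hpart M le_rfl)
  have h2 := abs_le.1 (hpart N hMN)
  have h3 := abs_le.1 hblocks
  rw [abs_le]
  constructor <;> linarith

lemma exists_abs_sum_sin_le_of_mul_le_one {b : ℕ → ℝ} {r : ℕ} (hr : 1 ≤ r)
    (hto : Tendsto (fun n : ℕ => (n : ℝ) * |b n|) atTop (nhds 0))
    (hsum : Summable (fun n : ℕ =>
      ∑ k ∈ Icc 1 (r / 2), |b (r * n + k) - b (r * n + r - k)|)) {ε : ℝ} (hε : 0 < ε) :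
    ∃ M₀ : ℕ, ∀ M, M₀ ≤ M → ∀ N, M ≤ N → ∀ (l : ℤ) (h : ℝ), ((N - M : ℕ) : ℝ) * |h| ≤ 1 →
      |∑ n ∈ Ico M N, b n * Real.sin (n * (2 * Real.pi * l / r + h))| ≤ ε := by
  obtain ⟨M₁, -, hsmall⟩ := exists_mul_abs_le hto (half_pos hε)
  obtain ⟨M₂, hcauchy⟩ := exists_abs_sum_sin_two_pi_div_le hr hto hsum (half_pos hε)
  refine ⟨max M₁ M₂, fun M hM N hMN l h hh => ?_⟩
  have hmain := hcauchy M ((le_max_right _ _).trans hM) N hMN l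
  set y : ℝ := 2 * Real.pi * l / r
  have hterm : ∀ n ∈ Ico M N,
      |b n * Real.sin (n * (y + h)) - b n * Real.sin (n * y)| ≤ ε / 2 * |h| := by
    intro n hn
    have h1 := hsmall n (((le_max_left _ _).trans hM).trans (mem_Ico.1 hn).1)
    have h2 : |Real.sin (n * (y + h)) - Real.sin (n * y)| ≤ n * |h| := by
      refine (Real.abs_sin_sub_sin_le _ _).trans_eq ?_
      rw [← mul_sub, add_sub_cancel_left, abs_mul, Nat.abs_cast]
    rw [← mul_sub, abs_mul]
    calc _ ≤ |b n| * (n * |h|) := by gcongr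
      _ = (n * |b n|) * |h| := by ring
      _ ≤ _ := by gcongr
  have herr : |∑ n ∈ Ico M N, b n * Real.sin (n * (y + h)) -
      ∑ n ∈ Ico M N, b n * Real.sin (n * y)| ≤ ε / 2 := by
    rw [← sum_sub_distrib]
    refine (abs_sum_le_sum_abs _ _).trans ((sum_le_card_nsmul _ _ _ hterm).trans ?_)
    rw [nsmul_eq_mul, Nat.card_Ico]
    nlinarith
  have h1 := abs_le.1 hmain
  have h2 := abs_le.1 herr
  rw [abs_le]
  constructor <;> linarith

lemma exists_eq_two_pi_mul_div_add {r : ℕ} (hr : 1 ≤ r) (x : ℝ) :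
    ∃ (l : ℤ) (h : ℝ), |h| ≤ Real.pi / r ∧ x = 2 * Real.pi * l / r + h := by
  have hrpos : (0 : ℝ) < r := by exact_mod_cast hr
  have hpi := Real.pi_pos
  set t : ℝ := x * r / (2 * Real.pi) with ht
  refine ⟨round t, 2 * Real.pi / r * (t - round t), ?_, ?_⟩
  · rw [abs_mul, abs_of_pos (by positivity)]
    calc _ ≤ 2 * Real.pi / r * (1 / 2) := by gcongr; exact abs_sub_round t
      _ = _ := by ring
  · rw [ht]
    field_simp
    ring

lemma exists_abs_sum_sin_le {b : ℕ → ℝ} {r : ℕ} (hr : 2 ≤ r) (hgm : GMstar b r)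
    (hto : Tendsto (fun n : ℕ => (n : ℝ) * |b n|) atTop (nhds 0))
    (hsum : Summable (fun n : ℕ =>
      ∑ k ∈ Icc 1 (r / 2), |b (r * n + k) - b (r * n + r - k)|)) {ε : ℝ} (hε : 0 < ε) :
    ∃ M₀ : ℕ, ∀ M, M₀ ≤ M → ∀ N, M ≤ N → ∀ x : ℝ,
      |∑ n ∈ Ico M N, b n * Real.sin (n * x)| ≤ ε := by
  obtain ⟨M₁, hM₁, hhigh⟩ := exists_abs_sum_sin_le_of_one_le_mul hr hgm hto (half_pos hε)
  obtain ⟨M₂, hlow⟩ := exists_abs_sum_sin_le_of_mul_le_one (by omega)  hto hsum (half_pos hε)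
  refine ⟨max M₁ M₂, fun M hM N hMN x => ?_⟩
  have hM1 : M₁ ≤ M := (le_max_left _ _).trans hM
  have hM2 : M₂ ≤ M := (le_max_right _ _).trans hM
  obtain ⟨l, h, hh, rfl⟩ := exists_eq_two_pi_mul_div_add (by omega : 1 ≤ r) x
  rcases eq_or_ne h 0 with rfl | hne
  · exact (hlow M hM2 N hMN l 0 (by simp)).trans (by linarith)
  have hpos : 0 < |h| := abs_pos.2 hne
  set T := ⌈1 / |h|⌉₊
  have hT : ∀ m, T ≤ m → 1 ≤ m * |h| := by
    intro m hm
    rw [← div_le_iff₀ hpos]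
    exact (Nat.le_ceil _).trans (by exact_mod_cast hm)
  have hT' : ∀ n ≤ T, ((n - M : ℕ) : ℝ) * |h| ≤ 1 := by
    intro n hn
    rw [← le_div_iff₀ hpos]
    have h1 : (T : ℝ) < 1 / |h| + 1 := Nat.ceil_lt_add_one (by positivity)
    have h2 : (n - M : ℕ) + 1 ≤ T ∨ n - M = 0 := by omega
    rcases h2 with h2 | h2
    · have h3 : ((n - M : ℕ) : ℝ) + 1 ≤ T := by exact_mod_cast h2
      linarith
    · rw [h2]
      simp
  rcases le_total T M with hTM | hMT
  · exact (hhigh M hM1 N l h hh (hT M hTM)).trans (by linarith)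
  rcases le_total N T with hNT | hTN
  · exact (hlow M hM2 N hMN l h (hT' N hNT)).trans (by linarith)
  rw [← sum_Ico_consecutive _ hMT hTN]
  have h1 := hlow M hM2 T hMT l h (hT' T le_rfl)
  have h2 := hhigh T (hM1.trans hMT) N l h hh (hT T le_rfl)
  exact (abs_add_le _ _).trans (by linarith)

lemma sinePartialSum_sub (b : ℕ → ℝ) {M N : ℕ} (hMN : M ≤ N) (x : ℝ) :
    sinePartialSum b N x - sinePartialSum b M x =
      ∑ n ∈ Ico (M + 1) (N + 1), b n * Real.sin (n * x) := by
  have h := sum_Ico_consecutive (fun n => b n * Real.sin (n * x))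
    (show 1 ≤ M + 1 by omega) (Nat.succ_le_succ hMN)
  change ∑ n ∈ Ico 1 (N + 1), b n * Real.sin (n * x) -
    ∑ n ∈ Ico 1 (M + 1), b n * Real.sin (n * x) = _
  linarith

theorem sufficiency_for_gm_star_r
    (r : ℕ) (hr : 3 ≤ r) (b : ℕ → ℝ) (hgm : GMstar b r)
    (hto : Tendsto (fun n : ℕ => (n : ℝ) * |b n|) atTop (nhds 0))
    (hsum : Summable (fun n : ℕ =>
      ∑ k ∈ Finset.Icc 1 (r / 2), |b (r * n + k) - b (r * n + r - k)|)) :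
    ∃ f : ℝ → ℝ, TendstoUniformly (fun N x => sinePartialSum b N x) f atTop := by
  have hcauchy : UniformCauchySeqOn (fun N x => sinePartialSum b N x) atTop Set.univ := by
    refine Metric.uniformCauchySeqOn_iff.2 fun ε hε => ?_
    obtain ⟨M₀, hM₀⟩ := exists_abs_sum_sin_le (by omega) hgm hto hsum (half_pos hε)
    refine ⟨M₀, fun m hm n hn x _ => ?_⟩
    wlog hmn : m ≤ n generalizing m n
    · rw [dist_comm]
      exact this n hn m hm (le_of_not_ge hmn)
    rw [dist_comm, Real.dist_eq, sinePartialSum_sub b hmn]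
    exact (hM₀ (m + 1) (by omega) (n + 1) (by omega) x).trans_lt (half_lt_self hε)
  choose f hf using fun x : ℝ =>
    cauchySeq_tendsto_of_complete (hcauchy.cauchySeq (Set.mem_univ x))
  exact ⟨f, tendstoUniformlyOn_univ.1 (hcauchy.tendstoUniformlyOn_of_tendsto fun x _ => hf x)⟩
end

section
/- Let (b_n)_{n≥1} be a real sequence belonging to GM(β*, 2) with witnessing constant c > 1, and suppose n·|b_n| → 0 as n → ∞. Set ε_n := sup_{k ≥ n/c} k·|b_k| and r_n(x) := ∑_{k=n}^∞ b_k sin(kx). Then there is a constant C > 0 (independent of n and x) such that |r_n(x)| ≤ C·ε_n for all x ∈ ℝ and all n ≥ 1. -/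
open Finset Filter

/-- If every dyadic block sum of a nonnegative sequence starting at `l` is at most `B / l`, then
all its partial sums starting at `l` are at most `2 * B / l`. -/
theorem sum_Ico_le_of_dyadic_block_le {a : ℕ → ℝ} (ha : ∀ k, 0 ≤ a k) {B : ℝ} (hB : 0 ≤ B) {m : ℕ}
    (hm : 1 ≤ m) (hblock : ∀ l, m ≤ l → ∑ k ∈ Icc l (2 * l - 1), a k ≤ B / l) (q : ℕ) :
    ∑ k ∈ Ico m q, a k ≤ 2 * B / m := by
  induction hd : q - m using Nat.strong_induction_on generalizing m with
  | _ d ih =>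
    have hm0 : (0 : ℝ) < m := by exact_mod_cast hm
    have hIcc : Icc m (2 * m - 1) = Ico m (2 * m) := by
      ext k
      simp only [mem_Icc, mem_Ico]
      omega
    have h0 := hblock m le_rfl
    rw [hIcc] at h0
    rcases le_or_gt q (2 * m) with hq | hq
    · calc ∑ k ∈ Ico m q, a k ≤ ∑ k ∈ Ico m (2 * m), a k :=
            sum_le_sum_of_subset_of_nonneg (Ico_subset_Ico_right hq) fun k _ _ => ha k
        _ ≤ B / m := h0
        _ ≤ 2 * B / m := by gcongr; linarith
    · rw [← sum_Ico_consecutive a (by omega : m ≤ 2 * m) hq.le]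
      have h1 := @ih (q - 2 * m) (by omega) (2 * m) (by omega)
        (fun l hl => hblock l (by omega)) rfl
      have h2 : 2 * B / ((2 * m : ℕ) : ℝ) = B / m := by
        push_cast
        field_simp
      have h3 : 2 * B / m = B / m + B / m := by ring
      linarith

/-- Summation by parts with step two. -/
theorem sum_Ico_mul_sub_step_two (b f : ℕ → ℝ) {p q : ℕ} (hpq : p ≤ q) :
    ∑ k ∈ Ico p q, b k * (f k - f (k + 2)) =
      b p * f p + b (p + 1) * f (p + 1) - b q * f q - b (q + 1) * f (q + 1) +
        ∑ k ∈ Ico p q, (b (k + 2) - b k) * f (k + 2) := by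
  induction q, hpq using Nat.le_induction with
  | base => simp
  | succ q hq ih =>
    rw [sum_Ico_succ_top hq, sum_Ico_succ_top hq, ih]
    ring

theorem abs_sin_natCast_mul_le (k : ℕ) (x : ℝ) :
    |Real.sin (k * x)| ≤ k * |Real.sin x| := by
  induction k with
  | zero => simp
  | succ k ih =>
    have h : ((k + 1 : ℕ) : ℝ) * x = k * x + x := by push_cast; ring
    rw [h, Real.sin_add]
    refine (abs_add_le _ _).trans ?_
    rw [abs_mul, abs_mul]
    have h1 := mul_le_mul ih (Real.abs_cos_le_one x) (abs_nonneg _) (by positivity)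
    have h2 := mul_le_mul_of_nonneg_right (Real.abs_cos_le_one (k * x)) (abs_nonneg (Real.sin x))
    push_cast
    linarith

/-- A sine sum whose coefficients are at most `ε / k` and whose step-two variation from `l` on
is at most `V / l` is bounded by a combination of `ε` and `V`, uniformly in `x`. -/
theorem abs_sum_Ico_mul_sin_le {b : ℕ → ℝ} {ε V : ℝ} {m : ℕ} (hm : 1 ≤ m) (hε : 0 ≤ ε)
    (hV : 0 ≤ V) (hb : ∀ k, m ≤ k → k * |b k| ≤ ε)
    (hvar : ∀ l, m ≤ l → ∀ q, ∑ k ∈ Ico l q, |b k - b (k + 2)| ≤ V / l) (q : ℕ) (x : ℝ) :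
    |∑ k ∈ Ico m q, b k * Real.sin (k * x)| ≤ 3 * ε + V := by
  have hlow : ∀ p, (∀ k, k < p → m ≤ k → (k : ℝ) * |Real.sin x| ≤ 1) →
      |∑ k ∈ Ico m p, b k * Real.sin (k * x)| ≤ ε := by
    intro p hp
    rcases le_or_gt p m with hpm | hpm
    · simpa [Ico_eq_empty_of_le hpm] using hε
    have hterm : ∀ k ∈ Ico m p, |b k * Real.sin (k * x)| ≤ ε * |Real.sin x| := by
      intro k hk
      rw [abs_mul]
      calc |b k| * |Real.sin (k * x)| ≤ |b k| * (k * |Real.sin x|) := by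
            gcongr; exact abs_sin_natCast_mul_le k x
        _ = (k * |b k|) * |Real.sin x| := by ring
        _ ≤ ε * |Real.sin x| := by gcongr; exact hb k (mem_Ico.1 hk).1
    refine (abs_sum_le_sum_abs _ _).trans ((sum_le_card_nsmul _ _ _ hterm).trans ?_)
    rw [Nat.card_Ico, nsmul_eq_mul]
    have h1 := hp (p - 1) (by omega) (by omega)
    have h2 : ((p - m : ℕ) : ℝ) ≤ ((p - 1 : ℕ) : ℝ) := by
      exact_mod_cast (by omega : p - m ≤ p - 1)
    calc ((p - m : ℕ) : ℝ) * (ε * |Real.sin x|)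
        ≤ ((p - 1 : ℕ) : ℝ) * (ε * |Real.sin x|) := by gcongr
      _ = ε * (((p - 1 : ℕ) : ℝ) * |Real.sin x|) := by ring
      _ ≤ ε * 1 := by gcongr
      _ = ε := mul_one ε
  have hhigh : ∀ p, m ≤ p → p ≤ q → 1 ≤ (p : ℝ) * |Real.sin x| →
      |∑ k ∈ Ico p q, b k * Real.sin (k * x)| ≤ 2 * ε + V := by
    intro p hmp hpq hps
    have hp0 : (0 : ℝ) < p := by exact_mod_cast (by omega : 0 < p)
    have hs : 0 < |Real.sin x| := by
      by_contra! h
      nlinarith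
    set f : ℕ → ℝ := fun k => Real.cos (((k : ℝ) - 1) * x) with hf
    have hf1 : ∀ k, |f k| ≤ 1 := fun k => Real.abs_cos_le_one _
    have hmul : 2 * Real.sin x * ∑ k ∈ Ico p q, b k * Real.sin (k * x) =
        ∑ k ∈ Ico p q, b k * (f k - f (k + 2)) := by
      rw [mul_sum]
      refine sum_congr rfl fun k _ => ?_
      have e1 : ((k : ℝ) - 1) * x = k * x - x := by ring
      have e2 : (((k + 2 : ℕ) : ℝ) - 1) * x = k * x + x := by push_cast; ring
      simp only [hf]
      rw [e1, e2, Real.cos_sub, Real.cos_add]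
      ring
    have hend : ∀ k, p ≤ k → |b k * f k| ≤ ε / p := by
      intro k hk
      rw [abs_mul, le_div_iff₀ hp0]
      calc |b k| * |f k| * p ≤ |b k| * 1 * k := by
            have : (p : ℝ) ≤ k := by exact_mod_cast hk
            gcongr
            exact hf1 k
        _ = k * |b k| := by ring
        _ ≤ ε := hb k (hmp.trans hk)
    have hsum : |∑ k ∈ Ico p q, (b (k + 2) - b k) * f (k + 2)| ≤ V / p := by
      refine (abs_sum_le_sum_abs _ _).trans (le_trans (sum_le_sum fun k _ => ?_) (hvar p hmp q))
      rw [abs_mul, abs_sub_comm]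
      exact mul_le_of_le_one_right (abs_nonneg _) (hf1 _)
    have hbd : |2 * Real.sin x * ∑ k ∈ Ico p q, b k * Real.sin (k * x)| ≤ (4 * ε + V) / p := by
      rw [hmul, sum_Ico_mul_sub_step_two b f hpq]
      have e : (4 * ε + V) / p = 4 * (ε / p) + V / p := by ring
      have h1 := abs_le.1 (hend p le_rfl)
      have h2 := abs_le.1 (hend (p + 1) (by omega))
      have h3 := abs_le.1 (hend q hpq)
      have h4 := abs_le.1 (hend (q + 1) (by omega))
      have h5 := abs_le.1 hsum
      rw [e, abs_le]
      constructor <;> linarith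
    rw [abs_mul, abs_mul, abs_two, le_div_iff₀ hp0] at hbd
    have := mul_le_mul_of_nonneg_right hps
      (abs_nonneg (∑ k ∈ Ico p q, b k * Real.sin (k * x)))
    nlinarith
  classical
  by_cases hex : ∃ p, m ≤ p ∧ p ≤ q ∧ 1 ≤ (p : ℝ) * |Real.sin x|
  · obtain ⟨hmp, hpq, hps⟩ := Nat.find_spec hex
    have hmin : ∀ k, k < Nat.find hex → m ≤ k → (k : ℝ) * |Real.sin x| ≤ 1 := by
      intro k hk hmk
      by_contra! h
      exact Nat.find_min hex hk ⟨hmk, by omega, h.le⟩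
    rw [← sum_Ico_consecutive _ hmp hpq]
    refine (abs_add_le _ _).trans ?_
    linarith [hlow _ hmin, hhigh _ hmp hpq hps]
  · push Not at hex
    linarith [hlow q fun k hk hmk => (hex k hmk hk.le).le]

/-- For sequences in `GM(β*, 2)` with constants `K` and `c`, the finite sections of the sine series
starting at `n` are bounded by any majorant of `k * |b k|` over `k ≥ n / c`. -/
theorem abs_sum_Ico_mul_sin_le_of_gm_two {b : ℕ → ℝ} {K c : ℝ} (hK : 0 < K) (hc : 1 < c)
    (hgm : ∀ m : ℕ, 1 ≤ m →
      (∑ n ∈ Icc m (2 * m - 1), |b n - b (n + 2)|) ≤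
        K * ((∑ k ∈ Icc m (m + 1), |b k|) +
          ∑ k ∈ Icc (max 1 ⌊(m : ℝ) / c⌋₊) ⌊c * (m : ℝ)⌋₊, |b k| / (k : ℝ)))
    {n : ℕ} (hn : 1 ≤ n) {ε : ℝ} (hb : ∀ k : ℕ, (n : ℝ) / c ≤ k → k * |b k| ≤ ε)
    (q : ℕ) (x : ℝ) :
    |∑ k ∈ Ico n q, b k * Real.sin (k * x)| ≤
      (c + 4 + 2 * (K * (2 + 4 * c ^ 3))) * ε := by
  have hc0 : 0 < c := by linarith
  have hn0 : (1 : ℝ) ≤ n := by exact_mod_cast hn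
  have hdiv : (n : ℝ) / c ≤ n := div_le_self (by linarith) hc.le
  have hbn : ∀ k : ℕ, n ≤ k → k * |b k| ≤ ε := fun k hk =>
    hb k (hdiv.trans (by exact_mod_cast hk))
  have hε : 0 ≤ ε := le_trans (by positivity) (hbn n le_rfl)
  have hb1 : ∀ k : ℕ, n ≤ k → |b k| ≤ ε / k := by
    intro k hk
    have : (0 : ℝ) < k := by exact_mod_cast (by omega : 0 < k)
    rw [le_div_iff₀ this, mul_comm]
    exact hbn k hk
  set m : ℕ := n + ⌈c⌉₊ with hmdef
  have hblock : ∀ l, m ≤ l →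
      ∑ k ∈ Icc l (2 * l - 1), |b k - b (k + 2)| ≤ (K * (2 + 4 * c ^ 3) * ε) / l := by
    intro l hl
    have hl0 : (0 : ℝ) < l := by exact_mod_cast (by omega : 0 < l)
    have hlc : (n : ℝ) + c ≤ l := by
      have h1 : ((n + ⌈c⌉₊ : ℕ) : ℝ) ≤ l := by exact_mod_cast hl
      push_cast at h1
      linarith [Nat.le_ceil c]
    have hy : (n : ℝ) / c + 1 ≤ l / c := by
      rw [div_add_one hc0.ne']
      gcongr
    have hfl : (l : ℝ) / c < (⌊(l : ℝ) / c⌋₊ : ℝ) + 1 := Nat.lt_floor_add_one _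
    have hpos : 0 < (n : ℝ) / c := by positivity
    have hfl1 : 1 ≤ ⌊(l : ℝ) / c⌋₊ := Nat.le_floor (by push_cast; linarith)
    have hfl1' : (1 : ℝ) ≤ (⌊(l : ℝ) / c⌋₊ : ℝ) := by exact_mod_cast hfl1
    have hfirst : ∑ k ∈ Icc l (l + 1), |b k| ≤ 2 * (ε / l) := by
      have hterm : ∀ k ∈ Icc l (l + 1), |b k| ≤ ε / l := by
        intro k hk
        have hk1 := (mem_Icc.1 hk).1
        refine (hb1 k (by omega)).trans ?_
        gcongr
      refine (sum_le_card_nsmul _ _ _ hterm).trans (le_of_eq ?_)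
      rw [Nat.card_Icc, nsmul_eq_mul, show l + 1 + 1 - l = 2 by omega]
      norm_num
    have hsecond : ∑ k ∈ Icc (max 1 ⌊(l : ℝ) / c⌋₊) ⌊c * (l : ℝ)⌋₊, |b k| / (k : ℝ) ≤
        4 * c ^ 3 * (ε / l) := by
      rw [max_eq_right hfl1]
      have hterm : ∀ k ∈ Icc ⌊(l : ℝ) / c⌋₊ ⌊c * (l : ℝ)⌋₊,
          |b k| / (k : ℝ) ≤ ε * (4 * c ^ 2) / (l : ℝ) ^ 2 := by
        intro k hk
        have hk1 : (⌊(l : ℝ) / c⌋₊ : ℝ) ≤ k := by exact_mod_cast (mem_Icc.1 hk).1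
        have hk0 : (0 : ℝ) < k := by linarith
        have hlk : (l : ℝ) ≤ 2 * c * k := by
          have : (l : ℝ) / c ≤ 2 * k := by linarith
          rw [div_le_iff₀ hc0] at this
          linarith
        have hkε := hb k (by linarith)
        rw [div_le_div_iff₀ hk0 (by positivity)]
        calc |b k| * (l : ℝ) ^ 2 ≤ |b k| * (2 * c * k) ^ 2 := by gcongr
          _ = (k * |b k|) * (4 * c ^ 2) * k := by ring
          _ ≤ ε * (4 * c ^ 2) * k := by gcongr
      refine (sum_le_card_nsmul _ _ _ hterm).trans ?_
      rw [Nat.card_Icc, nsmul_eq_mul]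
      have hcard : ((⌊c * (l : ℝ)⌋₊ + 1 - ⌊(l : ℝ) / c⌋₊ : ℕ) : ℝ) ≤ c * l := by
        refine le_trans ?_ (Nat.floor_le (by positivity : 0 ≤ c * (l : ℝ)))
        exact_mod_cast (by omega)
      calc ((⌊c * (l : ℝ)⌋₊ + 1 - ⌊(l : ℝ) / c⌋₊ : ℕ) : ℝ) * (ε * (4 * c ^ 2) / (l : ℝ) ^ 2)
          ≤ c * l * (ε * (4 * c ^ 2) / (l : ℝ) ^ 2) := by gcongr
        _ = 4 * c ^ 3 * (ε / l) := by field_simp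
    calc _ ≤ _ := hgm l (by omega)
      _ ≤ K * (2 * (ε / l) + 4 * c ^ 3 * (ε / l)) := by gcongr
      _ = _ := by ring
  have hA : 0 ≤ K * (2 + 4 * c ^ 3) * ε := by positivity
  have htail : ∀ q, |∑ k ∈ Ico m q, b k * Real.sin (k * x)| ≤
      3 * ε + 2 * (K * (2 + 4 * c ^ 3) * ε) := fun q =>
    abs_sum_Ico_mul_sin_le (by omega) hε (by positivity) (fun k hk => hbn k (by omega))
      (fun l hl q => sum_Ico_le_of_dyadic_block_le (fun _ => abs_nonneg _) hA (by omega)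
        (fun j hj => hblock j (hl.trans hj)) q) q x
  have hhead : ∀ p ≤ m, |∑ k ∈ Ico n p, b k * Real.sin (k * x)| ≤ (c + 1) * ε := by
    intro p hp
    have hterm : ∀ k ∈ Ico n p, |b k * Real.sin (k * x)| ≤ ε := by
      intro k hk
      have hnk := (mem_Ico.1 hk).1
      have hk1 : (1 : ℝ) ≤ k := by exact_mod_cast hn.trans hnk
      rw [abs_mul]
      calc |b k| * |Real.sin (k * x)| ≤ |b k| * 1 := by gcongr; exact Real.abs_sin_le_one _
        _ ≤ |b k| * k := by gcongr
        _ = k * |b k| := mul_comm _ _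
        _ ≤ ε := hbn k hnk
    refine (abs_sum_le_sum_abs _ _).trans ((sum_le_card_nsmul _ _ _ hterm).trans ?_)
    rw [Nat.card_Ico, nsmul_eq_mul]
    gcongr
    calc ((p - n : ℕ) : ℝ) ≤ (⌈c⌉₊ : ℝ) := by exact_mod_cast (by omega : p - n ≤ ⌈c⌉₊)
      _ ≤ c + 1 := (Nat.ceil_lt_add_one hc0.le).le
  rcases le_or_gt q m with hq | hq
  · have := hhead q hq
    linarith
  · rw [← sum_Ico_consecutive _ (by omega : n ≤ m) hq.le]
    refine (abs_add_le _ _).trans ?_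
    linarith [hhead m le_rfl, htail q]

theorem tail_estimate_gm_star_two
    (b : ℕ → ℝ) (K c : ℝ) (hK : 0 < K) (hc : 1 < c)
    (hgm : ∀ m : ℕ, 1 ≤ m →
      (∑ n ∈ Finset.Icc m (2 * m - 1), |b n - b (n + 2)|) ≤
        K * ((∑ k ∈ Finset.Icc m (m + 1), |b k|) +
          ∑ k ∈ Finset.Icc (max 1 ⌊(m : ℝ) / c⌋₊) ⌊c * (m : ℝ)⌋₊, |b k| / (k : ℝ)))
    (hto : Tendsto (fun n : ℕ => (n : ℝ) * |b n|) atTop (nhds 0)) :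
    ∃ rn : ℕ → ℝ → ℝ,
      (∀ n : ℕ, ∀ x : ℝ,
        Tendsto (fun N : ℕ => ∑ k ∈ Finset.Icc n N, b k * Real.sin (k * x)) atTop
          (nhds (rn n x))) ∧
      ∃ C : ℝ, 0 < C ∧ ∀ n : ℕ, 1 ≤ n → ∀ x : ℝ,
        |rn n x| ≤ C * sSup {y : ℝ | ∃ k : ℕ, (n : ℝ) / c ≤ (k : ℝ) ∧ y = (k : ℝ) * |b k|} := by
  have hc0 : 0 < c := by linarith
  set C : ℝ := c + 4 + 2 * (K * (2 + 4 * c ^ 3)) with hC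
  have hCpos : 0 < C := by positivity
  have hcauchy : ∀ x : ℝ, CauchySeq fun q : ℕ => ∑ k ∈ range q, b k * Real.sin (k * x) := by
    intro x
    rw [Metric.cauchySeq_iff']
    intro δ hδ
    obtain ⟨M, hM⟩ := eventually_atTop.1 (hto.eventually_lt_const (by positivity : 0 < δ / (2 * C)))
    refine ⟨⌈c * M⌉₊ + 1, fun q hq => ?_⟩
    rw [Real.dist_eq, ← sum_Ico_eq_sub _ hq]
    refine lt_of_le_of_lt (abs_sum_Ico_mul_sin_le_of_gm_two hK hc hgm (Nat.le_add_left 1 _)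
      (ε := δ / (2 * C)) (fun k hk => (hM k ?_).le) q x) ?_
    · rw [div_le_iff₀ hc0] at hk
      push_cast at hk
      have h1 : c * M ≤ c * k := by linarith [Nat.le_ceil (c * (M : ℝ))]
      exact_mod_cast le_of_mul_le_mul_left h1 hc0
    · rw [← hC]
      have : C * (δ / (2 * C)) = δ / 2 := by field_simp
      linarith
  choose S hS using fun x => cauchySeq_tendsto_of_complete (hcauchy x)
  have hlim : ∀ (n : ℕ) (x : ℝ),
      Tendsto (fun N : ℕ => ∑ k ∈ Icc n N, b k * Real.sin (k * x)) atTop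
        (nhds (S x - ∑ k ∈ range n, b k * Real.sin (k * x))) := by
    intro n x
    refine (((hS x).comp (tendsto_add_atTop_nat 1)).sub_const _).congr' ?_
    filter_upwards [eventually_ge_atTop n] with N hN
    simp only [Function.comp_apply]
    rw [← sum_Ico_eq_sub _ (by omega : n ≤ N + 1)]
    rfl
  refine ⟨fun n x => S x - ∑ k ∈ range n, b k * Real.sin (k * x), hlim, C, hCpos, ?_⟩
  intro n hn x
  obtain ⟨B, hB⟩ := hto.bddAbove_range
  have hbdd : BddAbove {y : ℝ | ∃ k : ℕ, (n : ℝ) / c ≤ (k : ℝ) ∧ y = (k : ℝ) * |b k|} := by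
    refine ⟨B, ?_⟩
    rintro y ⟨k, -, rfl⟩
    exact hB ⟨k, rfl⟩
  refine le_of_tendsto (hlim n x).abs (Eventually.of_forall fun N => ?_)
  exact abs_sum_Ico_mul_sin_le_of_gm_two hK hc hgm hn
    (fun k hk => le_csSup hbdd ⟨k, hk, rfl⟩) (N + 1) x
end
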